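/- Let f : α → α, g : β → β, h : γ → γ be dendrons on finite sets. If f × g is isomorphic to f × h, then g is isomorphic to h. -/

import Mathlib

/-- Two dynamical systems are isomorphic if there is a bijection commuting with the maps. -/
def FDSIso {α β : Type} (f : α → α) (g : β → β) : Prop :=
  ∃ e : α ≃ β, ∀ x, e (f x) = g (e x)

/-- A dendron is an FDS with a fixpoint which every state eventually reaches. -/
def IsDendron {α : Type} (f : α → α) : Prop :=
  ∃ r, f r = r ∧ ∀ x, ∃ n, f^[n] x = r

/-- The morphisms of dynamical systems from `t` to `g`. -/
abbrev FDSHom {τ β : Type} (t : τ → τ) (g : β → β) : Type :=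
  {φ : τ → β // ∀ x, φ (t x) = g (φ x)}

/-- The morphisms of dynamical systems from `t` to `g` whose kernel is `s`. -/
abbrev FDSHomKer {τ β : Type} (t : τ → τ) (g : β → β) (s : Setoid τ) : Type :=
  {φ : FDSHom t g // Setoid.ker φ.1 = s}

namespace FDSHom

/-- A morphism into a product is a pair of morphisms. -/
def prodEquiv {τ α β : Type} (t : τ → τ) (f : α → α) (g : β → β) :
    FDSHom t (Prod.map f g) ≃ FDSHom t f × FDSHom t g where
  toFun φ := (⟨fun x => (φ.1 x).1, fun x => by simp [φ.2 x]⟩,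
    ⟨fun x => (φ.1 x).2, fun x => by simp [φ.2 x]⟩)
  invFun p := ⟨fun x => (p.1.1 x, p.2.1 x), fun x => by simp [p.1.2 x, p.2.2 x]⟩
  left_inv _ := rfl
  right_inv _ := rfl

/-- Isomorphic systems receive the same morphisms. -/
def congrRight {τ α β : Type} (t : τ → τ) {f : α → α} {g : β → β}
    (e : α ≃ β) (he : ∀ x, e (f x) = g (e x)) : FDSHom t f ≃ FDSHom t g where
  toFun φ := ⟨fun x => e (φ.1 x), fun x => by simp only [φ.2 x, he]⟩
  invFun ψ := ⟨fun x => e.symm (ψ.1 x), fun x => by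
    simp only [ψ.2 x, Equiv.symm_apply_eq, he, Equiv.apply_symm_apply]⟩
  left_inv φ := by ext x; simp
  right_inv ψ := by ext x; simp

/-- Morphisms with kernel a congruence `s` are the injective morphisms from the quotient by `s`. -/
def kerEquiv {τ β : Type} (t : τ → τ) (g : β → β) (s : Setoid τ)
    (hs : ∀ x y, s x y → s (t x) (t y)) :
    FDSHomKer t g s ≃ FDSHomKer (Quotient.map t hs : Quotient s → Quotient s) g ⊥ where
  toFun φ := ⟨⟨Quotient.lift φ.1.1 fun x y hxy => by
      have hxy' : s x y := hxy
      rw [← φ.2] at hxy'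
      exact hxy', by
    rintro ⟨x⟩
    exact φ.1.2 x⟩, by
    ext ⟨x⟩ ⟨y⟩
    refine ⟨fun hxy => Quotient.sound ?_, fun hxy => ?_⟩
    · change s x y
      rw [← φ.2]
      exact hxy
    · have hxy' : s x y := Quotient.exact hxy
      rw [← φ.2] at hxy'
      exact hxy'⟩
  invFun ψ := ⟨⟨fun x => ψ.1.1 ⟦x⟧, fun x => ψ.1.2 ⟦x⟧⟩, by
    ext x y
    have h : Setoid.ker ψ.1.1 ⟦x⟧ ⟦y⟧ ↔ (⟦x⟧ : Quotient s) = ⟦y⟧ := by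
      rw [ψ.2]
      exact Iff.rfl
    exact h.trans Quotient.eq⟩
  left_inv _ := rfl
  right_inv ψ := by
    ext ⟨x⟩
    rfl

/-- The kernel of a morphism is a congruence. -/
theorem isEmpty_homKer {τ β : Type} (t : τ → τ) (g : β → β) (s : Setoid τ)
    (hs : ¬ ∀ x y, s x y → s (t x) (t y)) : IsEmpty (FDSHomKer t g s) := by
  refine ⟨fun φ => hs fun x y hxy => ?_⟩
  rw [← φ.2, Setoid.ker_def] at hxy ⊢
  rw [φ.1.2, φ.1.2, hxy]

theorem card_eq_sum {τ β : Type} [Finite τ] [Finite β] [Fintype (Setoid τ)]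
    (t : τ → τ) (g : β → β) :
    Nat.card (FDSHom t g) = ∑ s : Setoid τ, Nat.card (FDSHomKer t g s) := by
  rw [← Nat.card_sigma]
  exact Nat.card_congr (Equiv.sigmaFiberEquiv fun φ : FDSHom t g => Setoid.ker φ.1).symm

/-- If `g` and `h` receive equally many morphisms from every finite system, they receive equally
many injective ones. -/
theorem card_homKer_bot_eq {β γ : Type} [Finite β] [Finite γ] (g : β → β) (h : γ → γ)
    (hom_eq : ∀ (τ : Type) [Finite τ] (t : τ → τ),
      Nat.card (FDSHom t g) = Nat.card (FDSHom t h))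
    (τ : Type) [Finite τ] (t : τ → τ) :
    Nat.card (FDSHomKer t g ⊥) = Nat.card (FDSHomKer t h ⊥) := by
  classical
  induction hn : Nat.card τ using Nat.strong_induction_on generalizing τ with
  | _ n ih =>
    subst hn
    have : Finite (Setoid τ) :=
      Finite.of_injective (fun s : Setoid τ => (s : τ → τ → Prop)) fun _ _ => Setoid.eq_iff_rel_eq.2
    have := Fintype.ofFinite (Setoid τ)
    have key := hom_eq τ t
    rw [card_eq_sum, card_eq_sum, ← Finset.add_sum_erase _ _ (Finset.mem_univ ⊥),
      ← Finset.add_sum_erase _ _ (Finset.mem_univ ⊥)] at key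
    refine Nat.add_right_cancel (key.trans (congrArg _ (Finset.sum_congr rfl fun s hs => ?_)).symm)
    by_cases hc : ∀ x y, s x y → s (t x) (t y)
    · rw [Nat.card_congr (kerEquiv t g s hc), Nat.card_congr (kerEquiv t h s hc)]
      refine ih _ ?_ _ _ rfl
      refine (Nat.card_le_card_of_surjective _ Quotient.mk_surjective).lt_of_ne
        fun hcard => Finset.ne_of_mem_erase hs ?_
      have hinj := ((Nat.bijective_iff_surjective_and_card (Quotient.mk s)).2
        ⟨Quotient.mk_surjective, hcard.symm⟩).1
      ext x y
      exact Quotient.eq.symm.trans hinj.eq_iff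
    · have := isEmpty_homKer t g s hc
      have := isEmpty_homKer t h s hc
      simp

theorem injective_of_homKer_bot {τ β : Type} {t : τ → τ} {g : β → β} (φ : FDSHomKer t g ⊥) :
    Function.Injective φ.1.1 :=
  Setoid.ker_eq_bot_iff.1 φ.2

theorem nonempty_homKer_bot_self {β : Type} (g : β → β) : Nonempty (FDSHomKer g g ⊥) :=
  ⟨⟨⟨id, fun _ => rfl⟩, Setoid.ker_eq_bot_iff.2 Function.injective_id⟩⟩

end FDSHom

/-- Finite systems receiving equally many morphisms from every finite system are isomorphic. -/
theorem fdsIso_of_card_hom_eq {β γ : Type} [Finite β] [Finite γ] (g : β → β) (h : γ → γ)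
    (hom_eq : ∀ (τ : Type) [Finite τ] (t : τ → τ),
      Nat.card (FDSHom t g) = Nat.card (FDSHom t h)) : FDSIso g h := by
  have inj_eq := FDSHom.card_homKer_bot_eq g h hom_eq
  obtain ⟨φ⟩ : Nonempty (FDSHomKer g h ⊥) := by
    have := FDSHom.nonempty_homKer_bot_self g
    exact (Nat.card_pos_iff.1 (inj_eq β g ▸ Nat.card_pos)).1
  obtain ⟨ψ⟩ : Nonempty (FDSHomKer h g ⊥) := by
    have := FDSHom.nonempty_homKer_bot_self h
    exact (Nat.card_pos_iff.1 ((inj_eq γ h).symm ▸ Nat.card_pos)).1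
  have hφ := FDSHom.injective_of_homKer_bot φ
  have hψ := FDSHom.injective_of_homKer_bot ψ
  have hcard : Nat.card β = Nat.card γ :=
    le_antisymm (Nat.card_le_card_of_injective _ hφ) (Nat.card_le_card_of_injective _ hψ)
  exact ⟨Equiv.ofBijective φ.1.1 ((Nat.bijective_iff_injective_and_card _).2 ⟨hφ, hcard⟩), φ.1.2⟩

/-- Division is unambiguous among dendrons. -/
theorem dendron_cancel (α β γ : Type) [Fintype α] [Fintype β] [Fintype γ]
    (f : α → α) (g : β → β) (h : γ → γ)
    (hf : IsDendron f) (hg : IsDendron g) (hh : IsDendron h)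
    (hiso : FDSIso (Prod.map f g) (Prod.map f h)) :
    FDSIso g h := by
  obtain ⟨r, hr, -⟩ := hf
  obtain ⟨e, he⟩ := hiso
  refine fdsIso_of_card_hom_eq g h fun τ _ t => ?_
  have : Nonempty (FDSHom t f) := ⟨⟨fun _ => r, fun _ => hr.symm⟩⟩
  refine Nat.eq_of_mul_eq_mul_left (Nat.card_pos (α := FDSHom t f)) ?_
  rw [← Nat.card_prod, ← Nat.card_prod]
  exact Nat.card_congr <|
    (FDSHom.prodEquiv t f g).symm.trans <|
      (FDSHom.congrRight t e he).trans (FDSHom.prodEquiv t f h)
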